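/- There exists an absolute positive constant γ such that the following holds. Let U be an n×n real matrix with UᵀU = n·I and coherence μ = max_{k,j} |U_{k,j}|, fix T ⊆ {1,…,n} and t₀ ∉ T, let δ₁,…,δ_n be i.i.d. Bernoulli random variables with P(δ_k = 1) = m/n, and set Z₀ = ‖ Σ_{k=1}^n δ_k U_{k,t₀} u^k ‖, where u^k = (U_{k,t})_{t∈T}. Define σ̄² = μ² m · max(1, μ|T|/√m). Fix a > 0 obeying a ≤ (m/μ²)^{1/4} if μ|T|/√m > 1, and a ≤ (m/(μ²|T|))^{1/2} otherwise. Then P( Z₀ ≥ μ√(m|T|) + a·σ̄ ) ≤ e^{−γ a²}. -/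

import Mathlib

open Classical Finset Matrix Real

/-- Spectral (operator ℓ²) norm of a real matrix. -/
noncomputable def specNorm {ι κ : Type*} [Fintype ι] [Fintype κ] [DecidableEq κ]
    (A : Matrix ι κ ℝ) : ℝ :=
  ‖LinearMap.toContinuousLinearMap (Matrix.toEuclideanLin A)‖

/-- Coherence: the largest magnitude among the entries of `U`. -/
noncomputable def coh {n : ℕ} (U : Matrix (Fin n) (Fin n) ℝ) : ℝ :=
  ⨆ k, ⨆ j, |U k j|

/-- Uniform probability of the event `E` on the finite sample space `s`. -/
noncomputable def uprob {α : Type*} (s : Finset α) (E : α → Prop) : ℝ :=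
  ((s.filter E).card : ℝ) / s.card

/-- Weight of the outcome `ω` for i.i.d. Bernoulli(m/n) variables `δ_k = ω k`. -/
noncomputable def bweight (n m : ℕ) (ω : Fin n → Bool) : ℝ :=
  ∏ k, if ω k then (m : ℝ) / n else 1 - (m : ℝ) / n

/-- Expectation under the i.i.d. Bernoulli(m/n) model. -/
noncomputable def bexp (n m : ℕ) (f : (Fin n → Bool) → ℝ) : ℝ :=
  ∑ ω : Fin n → Bool, bweight n m ω * f ω

/-- Probability of an event under the i.i.d. Bernoulli(m/n) model. -/
noncomputable def bprob (n m : ℕ) (E : (Fin n → Bool) → Prop) : ℝ :=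
  ∑ ω : Fin n → Bool, if E ω then bweight n m ω else 0

/-- Euclidean norm of a finitely indexed real vector. -/
noncomputable def l2norm {ι : Type*} [Fintype ι] (v : ι → ℝ) : ℝ :=
  Real.sqrt (∑ i, v i ^ 2)

/-- Expectation of `F` under the product of `n` Bernoulli(`p`) laws. -/
noncomputable def bernExp (p : ℝ) (n : ℕ) (F : (Fin n → Bool) → ℝ) : ℝ :=
  ∑ ω : Fin n → Bool, (∏ k, if ω k then p else 1 - p) * F ω

section BernExp

variable {p : ℝ} {n : ℕ}

lemma bernExp_zero (F : (Fin 0 → Bool) → ℝ) : bernExp p 0 F = F default := by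
  rw [bernExp, Fintype.sum_unique, Fin.prod_univ_zero, one_mul]
  exact congrArg F (Subsingleton.elim _ _)

lemma bernExp_succ (F : (Fin (n + 1) → Bool) → ℝ) :
    bernExp p (n + 1) F = p * bernExp p n (fun ω => F (Fin.cons true ω)) +
      (1 - p) * bernExp p n (fun ω => F (Fin.cons false ω)) := by
  unfold bernExp
  rw [← (Fin.consEquiv (fun _ : Fin (n + 1) => Bool)).sum_comp, Fintype.sum_prod_type]
  simp [Fin.consEquiv, Fin.prod_univ_succ, Finset.mul_sum, mul_assoc]

lemma bernWeight_nonneg (hp0 : 0 ≤ p) (hp1 : p ≤ 1) (ω : Fin n → Bool) :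
    0 ≤ ∏ k, (if ω k then p else 1 - p) :=
  Finset.prod_nonneg fun k _ => by split_ifs <;> linarith

lemma bernExp_mono (hp0 : 0 ≤ p) (hp1 : p ≤ 1) {F G : (Fin n → Bool) → ℝ}
    (h : ∀ ω, F ω ≤ G ω) : bernExp p n F ≤ bernExp p n G :=
  Finset.sum_le_sum fun ω _ => mul_le_mul_of_nonneg_left (h ω) (bernWeight_nonneg hp0 hp1 ω)

lemma bernExp_add (F G : (Fin n → Bool) → ℝ) :
    bernExp p n (fun ω => F ω + G ω) = bernExp p n F + bernExp p n G := by
  simp [bernExp, mul_add, Finset.sum_add_distrib]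

lemma bernExp_const_mul (c : ℝ) (F : (Fin n → Bool) → ℝ) :
    bernExp p n (fun ω => c * F ω) = c * bernExp p n F := by
  simp only [bernExp, Finset.mul_sum]
  exact Finset.sum_congr rfl fun ω _ => by ring

lemma bernExp_sum {ι : Type*} (s : Finset ι) (F : ι → (Fin n → Bool) → ℝ) :
    bernExp p n (fun ω => ∑ i ∈ s, F i ω) = ∑ i ∈ s, bernExp p n (F i) := by
  simp only [bernExp, Finset.mul_sum]
  exact Finset.sum_comm

lemma bernExp_const (c : ℝ) : bernExp p n (fun _ => c) = c := by
  induction n with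
  | zero => simp [bernExp_zero]
  | succ n ih => rw [bernExp_succ, ih]; ring

lemma bernExp_pos (hp0 : 0 ≤ p) (hp1 : p ≤ 1) {F : (Fin n → Bool) → ℝ}
    (h : ∀ ω, 0 < F ω) : 0 < bernExp p n F := by
  obtain ⟨ω₀, hω₀⟩ := Finite.exists_min F
  calc 0 < F ω₀ := h ω₀
    _ = bernExp p n (fun _ => F ω₀) := (bernExp_const _).symm
    _ ≤ bernExp p n F := bernExp_mono hp0 hp1 hω₀

lemma bernExp_sq_affine (c : Fin n → ℝ) (s : ℝ) :
    bernExp p n (fun ω => (s + ∑ k, (if ω k then (1 : ℝ) else 0) * c k) ^ 2) =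
      (s + p * ∑ k, c k) ^ 2 + p * (1 - p) * ∑ k, c k ^ 2 := by
  induction n generalizing s with
  | zero => simp [bernExp_zero]
  | succ n ih =>
    have h1 := ih (fun k => c k.succ) (s + c 0)
    have h0 := ih (fun k => c k.succ) s
    rw [bernExp_succ]
    simp only [Fin.sum_univ_succ, Fin.cons_zero, Fin.cons_succ, if_true, one_mul,
      Bool.false_eq_true, if_false, zero_mul, zero_add, ← add_assoc]
    rw [h1, h0]
    ring

/-- Joint convexity and homogeneity of `(x, y) ↦ (x - y) * (log x - log y)`. -/
lemma sub_mul_log_sub_bernExp_le (hp0 : 0 ≤ p) (hp1 : p ≤ 1) {f g : (Fin n → Bool) → ℝ}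
    (hf : ∀ ω, 0 < f ω) (hg : ∀ ω, 0 < g ω) :
    (bernExp p n f - bernExp p n g) * (log (bernExp p n f) - log (bernExp p n g)) ≤
      bernExp p n (fun ω => (f ω - g ω) * (log (f ω) - log (g ω))) := by
  have key : ∀ f g : (Fin n → Bool) → ℝ, (∀ ω, 0 < f ω) → (∀ ω, 0 < g ω) →
      bernExp p n f * (log (bernExp p n f) - log (bernExp p n g)) ≤
        bernExp p n (fun ω => f ω * (log (f ω) - log (g ω))) := by
    intro f g hf hg
    have hX := bernExp_pos hp0 hp1 hf
    have hY := bernExp_pos hp0 hp1 hg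
    set X := bernExp p n f with hXdef
    set Y := bernExp p n g with hYdef
    have h : ∀ ω, (log X - log Y + 1) * f ω + (-(X / Y)) * g ω ≤
        f ω * (log (f ω) - log (g ω)) := by
      intro ω
      have hfω := hf ω
      have hgω := hg ω
      have hu := Real.one_sub_inv_le_log_of_pos (x := f ω * Y / (g ω * X)) (by positivity)
      rw [Real.log_div (by positivity) (by positivity), Real.log_mul hfω.ne' hY.ne',
        Real.log_mul hgω.ne' hX.ne'] at hu
      have h2 := mul_le_mul_of_nonneg_left hu hfω.le
      have h3 : f ω * (1 - (f ω * Y / (g ω * X))⁻¹) = f ω - X / Y * g ω := by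
        field_simp
      rw [h3] at h2
      linarith
    have := bernExp_mono hp0 hp1 h
    rw [bernExp_add, bernExp_const_mul, bernExp_const_mul, ← hXdef, ← hYdef] at this
    have h4 : X / Y * Y = X := by field_simp
    linarith
  have h1 := key f g hf hg
  have h2 := key g f hg hf
  have h3 : bernExp p n (fun ω => (f ω - g ω) * (log (f ω) - log (g ω))) =
      bernExp p n (fun ω => f ω * (log (f ω) - log (g ω))) +
        bernExp p n (fun ω => g ω * (log (g ω) - log (f ω))) := by
    rw [← bernExp_add]
    congr 1
    ext ω
    ring
  rw [h3]
  linarith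

lemma two_point_entropy_le (hp0 : 0 ≤ p) (hp1 : p ≤ 1) {x y : ℝ} (hx : 0 < x) (hy : 0 < y) :
    p * (x * log x) + (1 - p) * (y * log y) -
        (p * x + (1 - p) * y) * log (p * x + (1 - p) * y) ≤
      p * (1 - p) * ((x - y) * (log x - log y)) := by
  have hc := strictConcaveOn_log_Ioi.concaveOn.2 (Set.mem_Ioi.2 hx) (Set.mem_Ioi.2 hy) hp0
    (sub_nonneg.2 hp1) (by ring)
  simp only [smul_eq_mul] at hc
  have hpos : 0 ≤ p * x + (1 - p) * y :=
    add_nonneg (mul_nonneg hp0 hx.le) (mul_nonneg (sub_nonneg.2 hp1) hy.le)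
  nlinarith [mul_le_mul_of_nonneg_left hc hpos]

/-- Modified logarithmic Sobolev inequality on the Bernoulli cube. -/
lemma bernExp_entropy_le (hp0 : 0 ≤ p) (hp1 : p ≤ 1) {g : (Fin n → Bool) → ℝ}
    (hg : ∀ ω, 0 < g ω) :
    bernExp p n (fun ω => g ω * log (g ω)) - bernExp p n g * log (bernExp p n g) ≤
      p * (1 - p) * ∑ k, bernExp p n (fun ω =>
        (g (Function.update ω k true) - g (Function.update ω k false)) *
          (log (g (Function.update ω k true)) - log (g (Function.update ω k false)))) := by
  induction n with
  | zero => simp [bernExp_zero]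
  | succ n ih =>
    have i1 := ih (g := fun ω => g (Fin.cons true ω)) fun ω => hg _
    have i0 := ih (g := fun ω => g (Fin.cons false ω)) fun ω => hg _
    have j1 : 0 < bernExp p n (fun ω => g (Fin.cons true ω)) := bernExp_pos hp0 hp1 fun ω => hg _
    have j0 : 0 < bernExp p n (fun ω => g (Fin.cons false ω)) := bernExp_pos hp0 hp1 fun ω => hg _
    have h2 := two_point_entropy_le hp0 hp1 j1 j0
    have h3 := sub_mul_log_sub_bernExp_le hp0 hp1 (f := fun ω => g (Fin.cons true ω))
      (g := fun ω => g (Fin.cons false ω)) (fun ω => hg _) (fun ω => hg _)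
    have hq : 0 ≤ 1 - p := sub_nonneg.2 hp1
    have h4 := mul_le_mul_of_nonneg_left h3 (mul_nonneg hp0 hq)
    have h5 := mul_le_mul_of_nonneg_left i1 hp0
    have h6 := mul_le_mul_of_nonneg_left i0 hq
    rw [Fin.sum_univ_succ]
    simp only [bernExp_succ, Fin.update_cons_zero, ← Fin.cons_update, Finset.sum_add_distrib,
      ← Finset.mul_sum]
    linarith

/-- Herbst's argument: an entropy bound for `exp (l * f)` integrates to a bound on its mean. -/
lemma bernExp_exp_le_of_entropy_le (hp0 : 0 ≤ p) (hp1 : p ≤ 1) (f : (Fin n → Bool) → ℝ) {V L : ℝ}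
    (hL : 0 < L)
    (h : ∀ l, 0 < l → l ≤ L →
      bernExp p n (fun ω => exp (l * f ω) * (l * f ω)) -
        bernExp p n (fun ω => exp (l * f ω)) * log (bernExp p n (fun ω => exp (l * f ω))) ≤
      V * l ^ 2 * bernExp p n (fun ω => exp (l * f ω))) :
    bernExp p n (fun ω => exp (L * f ω)) ≤ exp (L * bernExp p n f + V * L ^ 2) := by
  set H : ℝ → ℝ := fun l => bernExp p n (fun ω => exp (l * f ω)) with hH
  have Hpos : ∀ l, 0 < H l := fun l => bernExp_pos hp0 hp1 fun ω => exp_pos _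
  have Hderiv : ∀ l, HasDerivAt H (bernExp p n (fun ω => exp (l * f ω) * f ω)) l := by
    intro l
    simp only [hH, bernExp]
    refine HasDerivAt.fun_sum fun ω _ => ?_
    refine HasDerivAt.const_mul _ ?_
    simpa using ((hasDerivAt_id l).mul_const (f ω)).exp
  set ψ : ℝ → ℝ := fun l => log (H l) with hψ
  have ψderiv : ∀ l, HasDerivAt ψ (bernExp p n (fun ω => exp (l * f ω) * f ω) / H l) l :=
    fun l => (Hderiv l).log (Hpos l).ne'
  have ψ0 : ψ 0 = 0 := by simp [hψ, hH, bernExp_const]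
  have φderiv : ∀ l, 0 < l → HasDerivAt (fun l => ψ l / l - V * l)
      ((bernExp p n (fun ω => exp (l * f ω) * f ω) / H l * l - ψ l * 1) / l ^ 2 - V * 1) l :=
    fun l hl => ((ψderiv l).div (hasDerivAt_id l) hl.ne').sub ((hasDerivAt_id l).const_mul V)
  have anti : AntitoneOn (fun l => ψ l / l - V * l) (Set.Ioc 0 L) := by
    refine antitoneOn_of_deriv_nonpos (convex_Ioc 0 L)
      (fun l hl => (φderiv l hl.1).continuousAt.continuousWithinAt) ?_ ?_
    · intro l hl
      rw [interior_Ioc] at hl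
      exact (φderiv l hl.1).differentiableAt.differentiableWithinAt
    · intro l hl
      rw [interior_Ioc] at hl
      rw [(φderiv l hl.1).deriv]
      have hl0 := hl.1
      have hent := h l hl.1 hl.2.le
      have e1 : bernExp p n (fun ω => exp (l * f ω) * (l * f ω)) =
          l * bernExp p n (fun ω => exp (l * f ω) * f ω) := by
        rw [← bernExp_const_mul]
        congr 1
        ext ω
        ring
      rw [e1] at hent
      have hHl := Hpos l
      have : (bernExp p n (fun ω => exp (l * f ω) * f ω) / H l * l - ψ l * 1) ≤ V * l ^ 2 := by
        have e2 : bernExp p n (fun ω => exp (l * f ω) * f ω) / H l * l - ψ l * 1 =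
            (l * bernExp p n (fun ω => exp (l * f ω) * f ω) - H l * log (H l)) / H l := by
          simp only [hψ]
          field_simp
        rw [e2, div_le_iff₀ hHl]
        exact hent
      have := (div_le_iff₀ (by positivity : (0 : ℝ) < l ^ 2)).2 this
      linarith
  have lim : Filter.Tendsto (fun l => ψ l / l - V * l) (nhdsWithin 0 (Set.Ioi 0))
      (nhds (bernExp p n f)) := by
    have h0 := (ψderiv 0).tendsto_slope_zero_right
    have e : bernExp p n (fun ω => exp (0 * f ω) * f ω) / H 0 = bernExp p n f := by
      simp [hH, bernExp_const]
    rw [e] at h0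
    have h1 : Filter.Tendsto (fun l : ℝ => V * l) (nhdsWithin 0 (Set.Ioi 0)) (nhds 0) := by
      have : Filter.Tendsto (fun l : ℝ => V * l) (nhds 0) (nhds (V * 0)) :=
        (continuous_const.mul continuous_id).tendsto 0
      rw [mul_zero] at this
      exact this.mono_left nhdsWithin_le_nhds
    have h2 := h0.sub h1
    rw [sub_zero] at h2
    refine h2.congr fun l => ?_
    simp [ψ0, div_eq_inv_mul]
  have fin : ψ L / L - V * L ≤ bernExp p n f := by
    refine ge_of_tendsto lim ?_
    filter_upwards [Ioc_mem_nhdsGT hL] with l hl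
    exact anti hl ⟨hL, le_rfl⟩ hl.2
  have : ψ L ≤ L * bernExp p n f + V * L ^ 2 := by
    have : ψ L / L ≤ bernExp p n f + V * L := by linarith
    rw [div_le_iff₀ hL] at this
    linarith
  exact (Real.log_le_iff_le_exp (Hpos L)).1 this

end BernExp

lemma mul_exp_sub_exp_le {x y w : ℝ} (hw : w = x ∨ w = y) (hxy : |x - y| ≤ 1) :
    (exp x - exp y) * (x - y) ≤ 3 * (x - y) ^ 2 * exp w := by
  have main : ∀ x y w : ℝ, (w = x ∨ w = y) → |x - y| ≤ 1 → y ≤ x →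
      (exp x - exp y) * (x - y) ≤ 3 * (x - y) ^ 2 * exp w := by
    intro x y w hw hxy hle
    have h1 : exp x - exp y ≤ (x - y) * exp x := by
      have := Real.add_one_le_exp (y - x)
      have h2 : exp y = exp (y - x) * exp x := by rw [← exp_add]; congr 1; ring
      nlinarith [exp_pos x]
    have h3 : exp x ≤ 3 * exp w := by
      rcases hw with rfl | rfl
      · linarith [exp_pos w]
      · have h2 : exp x = exp (x - w) * exp w := by rw [← exp_add]; congr 1; ring
        have h4 : exp (x - w) ≤ exp 1 := exp_le_exp.2 ((le_abs_self _).trans hxy)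
        have h5 := Real.exp_one_lt_d9
        rw [h2]
        exact mul_le_mul_of_nonneg_right (by linarith) (exp_pos _).le
    have hd : 0 ≤ x - y := by linarith
    calc (exp x - exp y) * (x - y) ≤ ((x - y) * exp x) * (x - y) :=
          mul_le_mul_of_nonneg_right h1 hd
      _ = (x - y) ^ 2 * exp x := by ring
      _ ≤ (x - y) ^ 2 * (3 * exp w) := mul_le_mul_of_nonneg_left h3 (sq_nonneg _)
      _ = _ := by ring
  rcases le_total y x with h | h
  · exact main x y w hw hxy h
  · have := main y x w hw.symm (by rwa [abs_sub_comm]) h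
    linarith

/-- The `C¹` function equal to `z` for `z ≥ R` and to `(z² + R²) / (2R)` for `z ≤ R`. -/
noncomputable def smoothMax (R z : ℝ) : ℝ := (z ^ 2 / max z R + max z R) / 2

lemma smoothMax_of_le {R z : ℝ} (hR : 0 < R) (h : R ≤ z) : smoothMax R z = z := by
  have : 0 < z := hR.trans_le h
  rw [smoothMax, max_eq_left h]
  field_simp
  ring

lemma smoothMax_of_ge {R z : ℝ} (h : z ≤ R) : smoothMax R z = (z ^ 2 / R + R) / 2 := by
  rw [smoothMax, max_eq_right h]

lemma smoothMax_le {R z : ℝ} (hR : 0 < R) : smoothMax R z ≤ (z ^ 2 / R + R) / 2 := by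
  rcases le_total R z with h | h
  · rw [smoothMax_of_le hR h, le_div_iff₀ two_pos, ← sub_nonneg]
    have : z ^ 2 / R + R - z * 2 = (z - R) ^ 2 / R := by field_simp; ring
    rw [this]
    positivity
  · rw [smoothMax_of_ge h]

lemma abs_smoothMax_sub_le {R x y : ℝ} (hR : 0 < R) (hx : 0 ≤ x) (hy : 0 ≤ y) :
    |smoothMax R x - smoothMax R y| ≤ |x - y| := by
  have main : ∀ x y : ℝ, 0 ≤ y → y ≤ x → |smoothMax R x - smoothMax R y| ≤ x - y := by
    intro x y hy hyx
    rw [abs_le]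
    rcases le_total R x with hRx | hRx <;> rcases le_total R y with hRy | hRy
    · rw [smoothMax_of_le hR hRx, smoothMax_of_le hR hRy]
      constructor <;> linarith
    · rw [smoothMax_of_le hR hRx, smoothMax_of_ge hRy]
      have h1 : y ^ 2 / R ≤ R := by rw [div_le_iff₀ hR]; nlinarith
      have h2 : 2 * y - R ≤ y ^ 2 / R := by rw [le_div_iff₀ hR]; nlinarith [sq_nonneg (y - R)]
      constructor <;> linarith
    · have : x = R := by linarith
      have : y = R := by linarith
      subst_vars
      simp
    · rw [smoothMax_of_ge hRx, smoothMax_of_ge hRy]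
      have h1 : x ^ 2 / R - y ^ 2 / R = (x - y) * ((x + y) / R) := by field_simp; ring
      have h2 : (x + y) / R ≤ 2 := by rw [div_le_iff₀ hR]; linarith
      have h3 : 0 ≤ (x + y) / R := div_nonneg (by linarith) hR.le
      constructor <;> nlinarith
  rcases le_total y x with h | h
  · rw [abs_of_nonneg (sub_nonneg.2 h)]
    exact main x y hy h
  · rw [abs_sub_comm, abs_sub_comm x, abs_of_nonneg (sub_nonneg.2 h)]
    exact main y x hx h

lemma abs_smoothMax_sub_mul_max_le {R x y : ℝ} (hR : 0 < R) (hx : 0 ≤ x) (hy : 0 ≤ y) :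
    |smoothMax R x - smoothMax R y| * max y R ≤ |x ^ 2 - y ^ 2| := by
  rcases le_total R x with hRx | hRx <;> rcases le_total R y with hRy | hRy
  · rw [smoothMax_of_le hR hRx, smoothMax_of_le hR hRy, max_eq_left hRy, sq_sub_sq, abs_mul,
      mul_comm, abs_of_nonneg (add_nonneg hx hy)]
    exact mul_le_mul_of_nonneg_right (by linarith) (abs_nonneg _)
  · rw [smoothMax_of_le hR hRx, smoothMax_of_ge hRy, max_eq_right hRy]
    have h1 : y ^ 2 / R ≤ R := by rw [div_le_iff₀ hR]; nlinarith
    rw [abs_of_nonneg (by linarith), abs_of_nonneg (by nlinarith)]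
    have h2 : (x - (y ^ 2 / R + R) / 2) * R = x * R - (y ^ 2 + R ^ 2) / 2 := by field_simp
    rw [h2]
    nlinarith [sq_nonneg (x - R)]
  · rw [smoothMax_of_ge hRx, smoothMax_of_le hR hRy, max_eq_left hRy, abs_sub_comm,
      abs_sub_comm (x ^ 2)]
    have h1 : x ^ 2 / R ≤ R := by rw [div_le_iff₀ hR]; nlinarith
    rw [abs_of_nonneg (by linarith), abs_of_nonneg (by nlinarith)]
    have h3 : x ^ 2 ≤ x ^ 2 / R * y := by
      rw [div_mul_eq_mul_div, le_div_iff₀ hR]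
      exact mul_le_mul_of_nonneg_left hRy (sq_nonneg x)
    have h4 : x ^ 2 ≤ R * y := h3.trans (mul_le_mul_of_nonneg_right h1 hy)
    nlinarith
  · rw [smoothMax_of_ge hRx, smoothMax_of_ge hRy, max_eq_right hRy]
    have h1 : (x ^ 2 / R + R) / 2 - (y ^ 2 / R + R) / 2 = (x ^ 2 - y ^ 2) / (2 * R) := by
      field_simp; ring
    rw [h1, abs_div, abs_of_pos (by positivity : 0 < 2 * R)]
    have h2 : |x ^ 2 - y ^ 2| / (2 * R) * R = |x ^ 2 - y ^ 2| / 2 := by field_simp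
    rw [h2]
    linarith [abs_nonneg (x ^ 2 - y ^ 2)]

/-- The sum of the vectors `y k` selected by `ω`. -/
noncomputable def selSum {E : Type*} [NormedAddCommGroup E] {n : ℕ} (y : Fin n → E)
    (ω : Fin n → Bool) : E :=
  ∑ k, if ω k then y k else 0

lemma selSum_update_true {E : Type*} [NormedAddCommGroup E] {n : ℕ} (y : Fin n → E)
    (ω : Fin n → Bool) (k : Fin n) :
    selSum y (Function.update ω k true) = selSum y (Function.update ω k false) + y k := by
  have h : ∀ b, selSum y (Function.update ω k b) =
      (if b then y k else 0) + ∑ j ∈ Finset.univ.erase k, if ω j then y j else 0 := by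
    intro b
    rw [selSum, ← Finset.add_sum_erase _ _ (Finset.mem_univ k), Function.update_self]
    congr 1
    exact Finset.sum_congr rfl fun j hj => by
      rw [Function.update_of_ne (Finset.ne_of_mem_erase hj)]
  rw [h, h]
  simp [add_comm]

section VectorSum

variable {E : Type*} [NormedAddCommGroup E] [InnerProductSpace ℝ E] {n : ℕ}

variable {p s B R : ℝ} {y : Fin n → E}

/-- The discrete derivative of `smoothMax R ‖selSum y ·‖` in the direction `k`. -/
lemma selSum_discrete_deriv (hR : 0 < R) (ω : Fin n → Bool) (k : Fin n) :
    ((smoothMax R ‖selSum y (Function.update ω k true)‖ -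
      smoothMax R ‖selSum y (Function.update ω k false)‖) * max ‖selSum y ω‖ R) ^ 2 ≤
      8 * inner ℝ (y k) (selSum y ω) ^ 2 + 2 * ‖y k‖ ^ 4 := by
  set S := selSum y ω with hS
  have key : ∀ (e : ℝ) (S' : E), e ^ 2 = 1 → S' = S + e • y k →
      ((smoothMax R ‖S'‖ - smoothMax R ‖S‖) * max ‖S‖ R) ^ 2 ≤
      8 * inner ℝ (y k) S ^ 2 + 2 * ‖y k‖ ^ 4 := by
    intro e S' he hS'
    have h1 := abs_smoothMax_sub_mul_max_le hR (norm_nonneg S') (norm_nonneg S)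
    have hm : 0 ≤ max ‖S‖ R := (norm_nonneg _).trans (le_max_left _ _)
    have h2 : ‖S'‖ ^ 2 - ‖S‖ ^ 2 = 2 * e * inner ℝ (y k) S + ‖y k‖ ^ 2 := by
      rw [hS', norm_add_sq_real, norm_smul, inner_smul_right, real_inner_comm, mul_pow,
        Real.norm_eq_abs, sq_abs, he]
      ring
    rw [← sq_abs, abs_mul, abs_of_nonneg hm]
    refine (pow_le_pow_left₀ (by positivity) h1 2).trans ?_
    rw [sq_abs, h2]
    nlinarith [sq_nonneg (2 * e * inner ℝ (y k) S - ‖y k‖ ^ 2)]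
  have hu := selSum_update_true y ω k
  rcases hb : ω k with _ | _
  · have h0 : Function.update ω k false = ω := by rw [← hb]; exact Function.update_eq_self k ω
    rw [h0] at hu ⊢
    exact key 1 _ (by norm_num) (by rw [hu]; simp [hS])
  · have h0 : Function.update ω k true = ω := by rw [← hb]; exact Function.update_eq_self k ω
    rw [h0] at hu ⊢
    rw [← neg_sq, ← neg_mul, neg_sub]
    exact key (-1) _ (by norm_num) (by rw [hS, hu]; simp)

/-- Exponential moment bound of Talagrand type for the norm of a Bernoulli selected sum. -/
lemma bernExp_exp_smoothMax_le (hp0 : 0 ≤ p) (hp1 : p ≤ 1) (hR : 0 < R) (hs : 0 ≤ s)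
    (hweak : ∀ v : E, p * ∑ k, inner ℝ (y k) v ^ 2 ≤ s * ‖v‖ ^ 2)
    (hy : ∀ k, ‖y k‖ ≤ B) (hstrong : p * ∑ k, ‖y k‖ ^ 2 ≤ R ^ 2)
    (hmean : bernExp p n (fun ω => ‖selSum y ω‖ ^ 2) ≤ R ^ 2) {l : ℝ} (hl : 0 < l)
    (hlB : l * B ≤ 1) :
    bernExp p n (fun ω => exp (l * smoothMax R ‖selSum y ω‖)) ≤
      exp (l * R + 3 * (8 * s + 2 * B ^ 2) * l ^ 2) := by
  set f : (Fin n → Bool) → ℝ := fun ω => smoothMax R ‖selSum y ω‖ with hf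
  have hfmean : bernExp p n f ≤ R := by
    calc bernExp p n f ≤ bernExp p n (fun ω => (2 * R)⁻¹ * ‖selSum y ω‖ ^ 2 + R / 2) := by
          refine bernExp_mono hp0 hp1 fun ω => (smoothMax_le hR).trans (le_of_eq ?_)
          field_simp
      _ = (2 * R)⁻¹ * bernExp p n (fun ω => ‖selSum y ω‖ ^ 2) + R / 2 := by
          rw [bernExp_add, bernExp_const_mul, bernExp_const]
      _ ≤ (2 * R)⁻¹ * R ^ 2 + R / 2 := by gcongr
      _ = R := by field_simp; ring
  have hgrad : ∀ ω, p * ∑ k, (f (Function.update ω k true) - f (Function.update ω k false)) ^ 2 ≤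
      8 * s + 2 * B ^ 2 := by
    intro ω
    set M := max ‖selSum y ω‖ R with hM
    have hRM : R ≤ M := le_max_right _ _
    have hzM : ‖selSum y ω‖ ≤ M := le_max_left _ _
    have hMpos : 0 < M := hR.trans_le hRM
    have h1 : p * ∑ k, ((f (Function.update ω k true) - f (Function.update ω k false)) * M) ^ 2 ≤
        8 * (p * ∑ k, inner ℝ (y k) (selSum y ω) ^ 2) + 2 * B ^ 2 * (p * ∑ k, ‖y k‖ ^ 2) := by
      have : ∑ k, ((f (Function.update ω k true) - f (Function.update ω k false)) * M) ^ 2 ≤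
          ∑ k, (8 * inner ℝ (y k) (selSum y ω) ^ 2 + 2 * B ^ 2 * ‖y k‖ ^ 2) := by
        refine Finset.sum_le_sum fun k _ => (selSum_discrete_deriv hR ω k).trans ?_
        have h2 : ‖y k‖ ^ 2 ≤ B ^ 2 := pow_le_pow_left₀ (norm_nonneg _) (hy k) 2
        nlinarith [mul_le_mul_of_nonneg_right h2 (sq_nonneg ‖y k‖)]
      rw [Finset.sum_add_distrib, ← Finset.mul_sum, ← Finset.mul_sum] at this
      nlinarith [mul_le_mul_of_nonneg_left this hp0]
    simp only [mul_pow] at h1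
    rw [← Finset.sum_mul, ← mul_assoc] at h1
    have h3 : ‖selSum y ω‖ ^ 2 ≤ M ^ 2 := pow_le_pow_left₀ (norm_nonneg _) hzM 2
    have h4 : R ^ 2 ≤ M ^ 2 := pow_le_pow_left₀ hR.le hRM 2
    have h5 : 8 * (p * ∑ k, inner ℝ (y k) (selSum y ω) ^ 2) ≤ 8 * (s * M ^ 2) := by
      have := hweak (selSum y ω)
      have := mul_le_mul_of_nonneg_left h3 hs
      linarith
    have h6 : 2 * B ^ 2 * (p * ∑ k, ‖y k‖ ^ 2) ≤ 2 * B ^ 2 * M ^ 2 :=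
      mul_le_mul_of_nonneg_left (hstrong.trans h4) (by positivity)
    refine le_of_mul_le_mul_right (h1.trans ?_) (by positivity : 0 < M ^ 2)
    linarith
  have hlip : ∀ ω k, |f (Function.update ω k true) - f (Function.update ω k false)| ≤ B := by
    intro ω k
    refine (abs_smoothMax_sub_le hR (norm_nonneg _) (norm_nonneg _)).trans ?_
    refine (abs_norm_sub_norm_le _ _).trans ?_
    rw [selSum_update_true, add_sub_cancel_left]
    exact hy k
  refine (bernExp_exp_le_of_entropy_le (V := 3 * (8 * s + 2 * B ^ 2)) hp0 hp1 f hl ?_).trans ?_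
  · intro r hr hrl
    have hent := bernExp_entropy_le hp0 hp1 (g := fun ω => exp (r * f ω)) fun ω => exp_pos _
    simp only [log_exp] at hent
    refine hent.trans ?_
    rw [← bernExp_sum, ← bernExp_const_mul, ← bernExp_const_mul]
    refine bernExp_mono hp0 hp1 fun ω => ?_
    have hk : ∀ k, (exp (r * f (Function.update ω k true)) -
        exp (r * f (Function.update ω k false))) *
        (r * f (Function.update ω k true) - r * f (Function.update ω k false)) ≤
        3 * r ^ 2 * exp (r * f ω) *
          (f (Function.update ω k true) - f (Function.update ω k false)) ^ 2 := by
      intro k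
      refine (mul_exp_sub_exp_le (w := r * f ω) ?_ ?_).trans (le_of_eq (by ring))
      · rcases hb : ω k with _ | _
        · right; rw [← hb, Function.update_eq_self]
        · left; rw [← hb, Function.update_eq_self]
      · rw [← mul_sub, abs_mul, abs_of_pos hr]
        exact (mul_le_mul hrl (hlip ω k) (abs_nonneg _) hl.le).trans hlB
    have hsum := Finset.sum_le_sum fun k (_ : k ∈ Finset.univ) => hk k
    rw [← Finset.mul_sum] at hsum
    set D := ∑ k, (f (Function.update ω k true) - f (Function.update ω k false)) ^ 2
    have hD : 0 ≤ D := Finset.sum_nonneg fun k _ => sq_nonneg _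
    have hA : 0 ≤ 3 * r ^ 2 * exp (r * f ω) := by positivity
    calc _ ≤ p * (1 - p) * (3 * r ^ 2 * exp (r * f ω) * D) :=
          mul_le_mul_of_nonneg_left hsum (mul_nonneg hp0 (sub_nonneg.2 hp1))
      _ ≤ p * (3 * r ^ 2 * exp (r * f ω) * D) := by
          refine mul_le_mul_of_nonneg_right ?_ (mul_nonneg hA hD)
          nlinarith
      _ = 3 * r ^ 2 * exp (r * f ω) * (p * D) := by ring
      _ ≤ 3 * r ^ 2 * exp (r * f ω) * (8 * s + 2 * B ^ 2) :=
          mul_le_mul_of_nonneg_left (hgrad ω) hA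
      _ = _ := by ring
  · refine exp_le_exp.2 ?_
    have := mul_le_mul_of_nonneg_left hfmean hl.le
    linarith

end VectorSum

lemma bprob_le_bernExp {n m : ℕ} (hmn : m ≤ n) {A : (Fin n → Bool) → Prop}
    {G : (Fin n → Bool) → ℝ} (hG : ∀ ω, 0 ≤ G ω) (hA : ∀ ω, A ω → 1 ≤ G ω) :
    bprob n m A ≤ bernExp ((m : ℝ) / n) n G := by
  refine Finset.sum_le_sum fun ω _ => ?_
  have hw : 0 ≤ bweight n m ω := bernWeight_nonneg (by positivity)
    (div_le_one_of_le₀ (by exact_mod_cast hmn) (by positivity)) ω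
  split_ifs with h
  · exact le_mul_of_one_le_right hw (hA ω h)
  · exact mul_nonneg hw (hG ω)

lemma abs_le_coh {n : ℕ} (U : Matrix (Fin n) (Fin n) ℝ) (k j : Fin n) : |U k j| ≤ coh U :=
  (le_ciSup (f := fun j => |U k j|) (Set.finite_range _).bddAbove j).trans
    (le_ciSup (f := fun k => ⨆ j, |U k j|) (Set.finite_range _).bddAbove k)

lemma sq_le_coh_sq {n : ℕ} (U : Matrix (Fin n) (Fin n) ℝ) (k j : Fin n) :
    U k j ^ 2 ≤ coh U ^ 2 :=
  sq_le_sq' (neg_le_of_abs_le (abs_le_coh U k j)) (le_of_abs_le (abs_le_coh U k j))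

section Columns

variable {n : ℕ} {U : Matrix (Fin n) (Fin n) ℝ}

lemma sum_mul_col (hU : Uᵀ * U = (n : ℝ) • (1 : Matrix (Fin n) (Fin n) ℝ)) (i j : Fin n) :
    ∑ k, U k i * U k j = if i = j then (n : ℝ) else 0 := by
  have h := congrFun (congrFun hU i) j
  simpa [Matrix.mul_apply, Matrix.one_apply] using h

lemma sum_sq_col (hU : Uᵀ * U = (n : ℝ) • (1 : Matrix (Fin n) (Fin n) ℝ)) (i : Fin n) :
    ∑ k, U k i ^ 2 = n := by
  simpa [sq] using sum_mul_col hU i i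

lemma one_le_coh (hU : Uᵀ * U = (n : ℝ) • (1 : Matrix (Fin n) (Fin n) ℝ)) (i : Fin n) :
    1 ≤ coh U := by
  have hn : (0 : ℝ) < n := by exact_mod_cast i.pos
  have h0 : 0 ≤ coh U := (abs_nonneg _).trans (abs_le_coh U i i)
  have h : (n : ℝ) ≤ n * coh U ^ 2 := by
    calc (n : ℝ) = ∑ k, U k i ^ 2 := (sum_sq_col hU i).symm
      _ ≤ ∑ _k : Fin n, coh U ^ 2 := Finset.sum_le_sum fun k _ => sq_le_coh_sq U k i
      _ = n * coh U ^ 2 := by simp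
  have : 1 ≤ coh U ^ 2 := by
    by_contra hc
    nlinarith
  nlinarith

lemma sum_sq_sum_col (hU : Uᵀ * U = (n : ℝ) • (1 : Matrix (Fin n) (Fin n) ℝ))
    (T : Finset (Fin n)) (v : T → ℝ) :
    ∑ k, (∑ t : T, U k t * v t) ^ 2 = n * ∑ t, v t ^ 2 := by
  calc ∑ k, (∑ t : T, U k t * v t) ^ 2
      = ∑ k, ∑ t : T, ∑ t' : T, (v t * v t') * (U k t * U k t') := by
        refine Finset.sum_congr rfl fun k _ => ?_
        rw [sq, Finset.sum_mul_sum]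
        exact Finset.sum_congr rfl fun t _ => Finset.sum_congr rfl fun t' _ => by ring
    _ = ∑ t : T, ∑ t' : T, (v t * v t') * ∑ k, U k t * U k t' := by
        rw [Finset.sum_comm]
        refine Finset.sum_congr rfl fun t _ => ?_
        rw [Finset.sum_comm]
        exact Finset.sum_congr rfl fun t' _ => (Finset.mul_sum _ _ _).symm
    _ = n * ∑ t, v t ^ 2 := by
        simp only [sum_mul_col hU, Subtype.coe_inj, mul_ite, mul_zero, Finset.sum_ite_eq,
          Finset.mem_univ, if_true, Finset.mul_sum]
        exact Finset.sum_congr rfl fun t _ => by ring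

/-- The row `k` of `U` restricted to `T`, multiplied by `U k t₀`. -/
noncomputable def scaledRow (U : Matrix (Fin n) (Fin n) ℝ) (T : Finset (Fin n)) (t₀ k : Fin n) :
    EuclideanSpace ℝ T :=
  WithLp.toLp 2 fun t => U k t₀ * U k t

variable {T : Finset (Fin n)} {t₀ : Fin n}

lemma norm_scaledRow_sq (k : Fin n) :
    ‖scaledRow U T t₀ k‖ ^ 2 = ∑ t : T, (U k t₀ * U k t) ^ 2 := by
  simp only [EuclideanSpace.norm_sq_eq, scaledRow, Real.norm_eq_abs, sq_abs]

lemma selSum_scaledRow_apply (ω : Fin n → Bool) (t : T) :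
    selSum (scaledRow U T t₀) ω t =
      ∑ k, (if ω k then (1 : ℝ) else 0) * (U k t₀ * U k t) := by
  rw [selSum, WithLp.ofLp_sum, Finset.sum_apply]
  refine Finset.sum_congr rfl fun k _ => ?_
  split_ifs <;> simp [scaledRow]

lemma l2norm_eq_norm_selSum (ω : Fin n → Bool) :
    l2norm (fun t : T => ∑ k : Fin n, (if ω k then (1 : ℝ) else 0) * U k t₀ * U k t.1) =
      ‖selSum (scaledRow U T t₀) ω‖ := by
  simp [l2norm, EuclideanSpace.norm_eq, selSum_scaledRow_apply]

lemma norm_scaledRow_le (k : Fin n) :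
    ‖scaledRow U T t₀ k‖ ≤ coh U ^ 2 * √(T.card : ℝ) := by
  refine (sq_le_sq₀ (by positivity) (by positivity)).1 ?_
  rw [norm_scaledRow_sq, mul_pow, Real.sq_sqrt (Nat.cast_nonneg _)]
  calc ∑ t : T, (U k t₀ * U k t) ^ 2 ≤ ∑ _t : T, (coh U ^ 2) ^ 2 := by
        refine Finset.sum_le_sum fun t _ => ?_
        rw [mul_pow, sq (coh U ^ 2)]
        exact mul_le_mul (sq_le_coh_sq U _ _) (sq_le_coh_sq U _ _) (sq_nonneg _) (sq_nonneg _)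
    _ = (coh U ^ 2) ^ 2 * T.card := by simp [mul_comm]

lemma sum_norm_scaledRow_sq_le (hU : Uᵀ * U = (n : ℝ) • (1 : Matrix (Fin n) (Fin n) ℝ)) :
    ∑ k, ‖scaledRow U T t₀ k‖ ^ 2 ≤ n * (coh U ^ 2 * T.card) := by
  simp only [norm_scaledRow_sq]
  rw [Finset.sum_comm]
  calc ∑ t : T, ∑ k, (U k t₀ * U k t) ^ 2 ≤ ∑ t : T, ∑ k, coh U ^ 2 * U k t ^ 2 := by
        refine Finset.sum_le_sum fun t _ => Finset.sum_le_sum fun k _ => ?_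
        rw [mul_pow]
        exact mul_le_mul_of_nonneg_right (sq_le_coh_sq U _ _) (sq_nonneg _)
    _ = n * (coh U ^ 2 * T.card) := by
        simp only [← Finset.mul_sum, sum_sq_col hU]
        simp
        ring

lemma sum_inner_scaledRow_sq_le (hU : Uᵀ * U = (n : ℝ) • (1 : Matrix (Fin n) (Fin n) ℝ))
    (v : EuclideanSpace ℝ T) :
    ∑ k, inner ℝ (scaledRow U T t₀ k) v ^ 2 ≤ n * (coh U ^ 2 * ‖v‖ ^ 2) := by
  have h : ∀ k, inner ℝ (scaledRow U T t₀ k) v = U k t₀ * ∑ t : T, U k t * v t := by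
    intro k
    rw [PiLp.inner_apply, Finset.mul_sum]
    refine Finset.sum_congr rfl fun t _ => ?_
    simp [scaledRow]
    ring
  calc ∑ k, inner ℝ (scaledRow U T t₀ k) v ^ 2
      ≤ ∑ k, coh U ^ 2 * (∑ t : T, U k t * v t) ^ 2 := by
        refine Finset.sum_le_sum fun k _ => ?_
        rw [h, mul_pow]
        exact mul_le_mul_of_nonneg_right (sq_le_coh_sq U _ _) (sq_nonneg _)
    _ = n * (coh U ^ 2 * ‖v‖ ^ 2) := by
        rw [← Finset.mul_sum, sum_sq_sum_col hU, EuclideanSpace.norm_sq_eq]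
        simp only [Real.norm_eq_abs, sq_abs]
        ring

lemma bernExp_norm_selSum_scaledRow_sq_le
    (hU : Uᵀ * U = (n : ℝ) • (1 : Matrix (Fin n) (Fin n) ℝ)) (ht₀ : t₀ ∉ T) {p : ℝ}
    (hp0 : 0 ≤ p) :
    bernExp p n (fun ω => ‖selSum (scaledRow U T t₀) ω‖ ^ 2) ≤
      p * ∑ k, ‖scaledRow U T t₀ k‖ ^ 2 := by
  have h : ∀ t : T, bernExp p n (fun ω => selSum (scaledRow U T t₀) ω t ^ 2) ≤
      p * ∑ k, (U k t₀ * U k t) ^ 2 := by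
    intro t
    have ht : t₀ ≠ t := fun h => ht₀ (h ▸ t.2)
    have := bernExp_sq_affine (p := p) (fun k => U k t₀ * U k t) 0
    simp only [zero_add, sum_mul_col hU, ht, if_false, mul_zero] at this
    simp only [selSum_scaledRow_apply, this]
    have h0 : 0 ≤ ∑ k, (U k t₀ * U k t) ^ 2 := Finset.sum_nonneg fun k _ => sq_nonneg _
    nlinarith [mul_nonneg (mul_nonneg hp0 hp0) h0]
  calc bernExp p n (fun ω => ‖selSum (scaledRow U T t₀) ω‖ ^ 2)
      = ∑ t : T, bernExp p n (fun ω => selSum (scaledRow U T t₀) ω t ^ 2) := by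
        rw [← bernExp_sum]
        simp [EuclideanSpace.norm_sq_eq]
    _ ≤ ∑ t : T, p * ∑ k, (U k t₀ * U k t) ^ 2 := Finset.sum_le_sum fun t _ => h t
    _ = p * ∑ k, ‖scaledRow U T t₀ k‖ ^ 2 := by
        simp only [norm_scaledRow_sq]
        rw [← Finset.mul_sum, Finset.sum_comm]

end Columns

/-- Comparison of the scales entering the deviation bound, where `w = √m` and `N = |T|`. -/
lemma scale_bounds {μ w N a : ℝ} (hμ : 1 ≤ μ) (hw : 1 ≤ w) (hN : 1 ≤ N) (ha : 0 < a)
    (h : if 1 < μ * N / w then a ≤ (w ^ 2 / μ ^ 2) ^ ((1 : ℝ) / 4)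
      else a ≤ (w ^ 2 / (μ ^ 2 * N)) ^ ((1 : ℝ) / 2)) :
    (μ ^ 4 * N ≤ μ ^ 2 * w ^ 2 * max 1 (μ * N / w) ∧
      a ^ 2 * (μ ^ 4 * N) ≤ μ ^ 2 * w ^ 2 * max 1 (μ * N / w)) ∨
    (a ≤ 1 ∧ μ ^ 2 * w ^ 2 * N ≤ μ ^ 2 * w ^ 2 * max 1 (μ * N / w)) := by
  have hμ0 : 0 < μ := by linarith
  have hw0 : 0 < w := by linarith
  have hN0 : 0 < N := by linarith
  split_ifs at h with hc
  · rw [max_eq_right hc.le]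
    have e : μ ^ 2 * w ^ 2 * (μ * N / w) = μ ^ 3 * N * w := by field_simp
    have ha2 : a ^ 2 * μ ≤ w := by
      have h4 : a ^ 4 ≤ w ^ 2 / μ ^ 2 := by
        have := pow_le_pow_left₀ ha.le h 4
        rwa [← Real.rpow_natCast (_ ^ _), ← Real.rpow_mul (by positivity),
          show (1 : ℝ) / 4 * (4 : ℕ) = 1 by norm_num, Real.rpow_one] at this
      rw [le_div_iff₀ (by positivity)] at h4
      refine (sq_le_sq₀ (by positivity) hw0.le).1 ?_
      linarith [show (a ^ 2 * μ) ^ 2 = a ^ 4 * μ ^ 2 by ring]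
    rw [e]
    rcases le_or_gt μ w with hμw | hμw
    · left
      constructor
      · linarith [mul_le_mul_of_nonneg_left hμw (by positivity : 0 ≤ μ ^ 3 * N)]
      · linarith [mul_le_mul_of_nonneg_left ha2 (by positivity : 0 ≤ μ ^ 3 * N)]
    · right
      constructor
      · by_contra! h1
        have h2 : 1 * μ ≤ a ^ 2 * μ := by gcongr; exact one_le_pow₀ h1.le
        linarith
      · linarith [mul_le_mul_of_nonneg_left hμw.le (by positivity : 0 ≤ μ ^ 2 * w * N)]
  · have hc' := not_lt.1 hc
    left
    rw [max_eq_left hc', mul_one]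
    rw [div_le_one hw0] at hc'
    have hμw : μ ≤ w := by nlinarith
    have ha2 : a ^ 2 * (μ ^ 2 * N) ≤ w ^ 2 := by
      have := pow_le_pow_left₀ ha.le h 2
      rwa [← Real.rpow_natCast (_ ^ _), ← Real.rpow_mul (by positivity),
        show (1 : ℝ) / 2 * (2 : ℕ) = 1 by norm_num, Real.rpow_one,
        le_div_iff₀ (by positivity)] at this
    constructor
    · have h1 : μ * (μ * N) ≤ w * w := mul_le_mul hμw hc' (by positivity) hw0.le
      linarith [mul_le_mul_of_nonneg_left h1 (by positivity : 0 ≤ μ ^ 2)]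
    · linarith [mul_le_mul_of_nonneg_left ha2 (by positivity : 0 ≤ μ ^ 2)]

/-- Lemma 3.4.  There is an absolute constant `γ > 0` such that:
with coherence `μ`, `t₀ ∉ T`, i.i.d. Bernoulli(m/n) variables `δ_k`,
`Z₀ = ‖Σ_k δ_k U_{k,t₀} u^k‖`, and `σ̄² = μ²m·max(1, μ|T|/√m)`, for every `a > 0`
obeying `a ≤ (m/μ²)^{1/4}` if `μ|T|/√m > 1` and `a ≤ (m/(μ²|T|))^{1/2}` otherwise,
one has `P(Z₀ ≥ μ√(m|T|) + a·σ̄) ≤ exp(-γa²)`. -/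
theorem statement9 :
    ∃ γ : ℝ, 0 < γ ∧
      ∀ (n m : ℕ) (U : Matrix (Fin n) (Fin n) ℝ),
        Uᵀ * U = (n : ℝ) • (1 : Matrix (Fin n) (Fin n) ℝ) →
        ∀ (T : Finset (Fin n)) (t₀ : Fin n), t₀ ∉ T →
          0 < m → m ≤ n →
          ∀ a : ℝ, 0 < a →
            (if 1 < coh U * T.card / Real.sqrt m then
                a ≤ ((m : ℝ) / coh U ^ 2) ^ ((1 : ℝ) / 4)
              else a ≤ ((m : ℝ) / (coh U ^ 2 * T.card)) ^ ((1 : ℝ) / 2)) →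
            bprob n m
                (fun ω =>
                  coh U * Real.sqrt ((m : ℝ) * T.card) +
                      a * Real.sqrt (coh U ^ 2 * m *
                        max 1 (coh U * T.card / Real.sqrt m)) ≤
                    l2norm
                      (fun t : ↥T =>
                        ∑ k : Fin n,
                          (if ω k then (1 : ℝ) else 0) * U k t₀ * U k t.1)) ≤
              Real.exp (-(γ * a ^ 2)) := by
  refine ⟨1 / 120, by norm_num, ?_⟩
  intro n m U hU T t₀ ht₀ hm hmn a ha hcond
  have hn : (0 : ℝ) < n := by exact_mod_cast hm.trans_le hmn
  have hm1 : (1 : ℝ) ≤ m := by exact_mod_cast hm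
  have hμ := one_le_coh hU t₀
  simp only [l2norm_eq_norm_selSum]
  rcases T.eq_empty_or_nonempty with rfl | hT
  · simp only [Finset.card_empty, Nat.cast_zero, mul_zero, zero_div, div_zero] at hcond
    rw [if_neg (by norm_num), Real.zero_rpow (by norm_num)] at hcond
    linarith
  have hN : (1 : ℝ) ≤ (T.card : ℝ) := by exact_mod_cast hT.card_pos
  set y := scaledRow U T t₀ with hydef
  set μ := coh U with hμdef
  set N : ℝ := (T.card : ℝ) with hNdef
  set p : ℝ := (m : ℝ) / n with hp
  have hp0 : 0 ≤ p := by positivity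
  have hp1 : p ≤ 1 := div_le_one_of_le₀ (by exact_mod_cast hmn) hn.le
  have hpn : p * n = m := by rw [hp]; field_simp
  have hw1 : 1 ≤ √(m : ℝ) := Real.one_le_sqrt.2 hm1
  have hw2 : √(m : ℝ) ^ 2 = m := Real.sq_sqrt (by linarith)
  have hscale := scale_bounds hμ hw1 hN ha (by rwa [hw2])
  rw [hw2] at hscale
  have hmax : 1 ≤ max 1 (μ * N / √(m : ℝ)) := le_max_left _ _
  set σ := √(μ ^ 2 * m * max 1 (μ * N / √(m : ℝ))) with hσdef
  have hσ2 : σ ^ 2 = μ ^ 2 * m * max 1 (μ * N / √(m : ℝ)) := Real.sq_sqrt (by positivity)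
  have hσ : 0 < σ := Real.sqrt_pos.2 (by positivity)
  rw [← hσ2] at hscale
  set R := μ * √((m : ℝ) * N) with hRdef
  have hR : 0 < R := by positivity
  have hR2 : R ^ 2 = μ ^ 2 * m * N := by
    rw [hRdef, mul_pow, Real.sq_sqrt (by positivity)]
    ring
  have hstrong : p * ∑ k, ‖y k‖ ^ 2 ≤ R ^ 2 := by
    have := mul_le_mul_of_nonneg_left (sum_norm_scaledRow_sq_le (T := T) (t₀ := t₀) hU) hp0
    rw [← mul_assoc, hpn] at this
    rw [hR2]
    linarith
  have hmean : bernExp p n (fun ω => ‖selSum y ω‖ ^ 2) ≤ R ^ 2 :=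
    (bernExp_norm_selSum_scaledRow_sq_le hU ht₀ hp0).trans hstrong
  rcases hscale with ⟨hB, haB⟩ | ⟨ha1, hRσ⟩
  · have hweak : ∀ v : EuclideanSpace ℝ T,
        p * ∑ k, inner ℝ (y k) v ^ 2 ≤ (m * μ ^ 2) * ‖v‖ ^ 2 := by
      intro v
      have := mul_le_mul_of_nonneg_left (sum_inner_scaledRow_sq_le (t₀ := t₀) hU v) hp0
      rw [← mul_assoc, hpn] at this
      linarith
    set B := μ ^ 2 * √N with hBdef
    have hB2 : B ^ 2 = μ ^ 4 * N := by
      rw [hBdef, mul_pow, Real.sq_sqrt (by positivity)]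
      ring
    rw [← hB2] at hB haB
    have haB' : a * B ≤ σ := by
      refine (sq_le_sq₀ (by positivity) hσ.le).1 ?_
      rwa [mul_pow]
    have hs : (m : ℝ) * μ ^ 2 ≤ σ ^ 2 := by
      rw [hσ2, mul_comm (m : ℝ)]
      exact le_mul_of_one_le_right (by positivity) hmax
    have hl : 0 < a / (60 * σ) := by positivity
    have hlB : a / (60 * σ) * B ≤ 1 := by
      rw [div_mul_eq_mul_div, div_le_one (by positivity)]
      linarith
    have hexp := bernExp_exp_smoothMax_le hp0 hp1 hR (by positivity) hweak norm_scaledRow_le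
      hstrong hmean hl hlB
    set l := a / (60 * σ) with hldef
    have hlσ : l * σ = a / 60 := by rw [hldef]; field_simp
    calc _ ≤ bernExp p n
            (fun ω => exp (-(l * (R + a * σ))) * exp (l * smoothMax R ‖selSum y ω‖)) := by
          refine bprob_le_bernExp hmn (fun ω => by positivity) fun ω hω => ?_
          have hRz : R ≤ ‖selSum y ω‖ := (le_add_of_nonneg_right (by positivity)).trans hω
          rw [smoothMax_of_le hR hRz, ← exp_add, Real.one_le_exp_iff]
          linarith [mul_le_mul_of_nonneg_left hω hl.le]
      _ ≤ exp (-(l * (R + a * σ))) * exp (l * R + 3 * (8 * (m * μ ^ 2) + 2 * B ^ 2) * l ^ 2) := by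
          rw [bernExp_const_mul]
          exact mul_le_mul_of_nonneg_left hexp (exp_pos _).le
      _ ≤ exp (-(1 / 120 * a ^ 2)) := by
          rw [← exp_add, exp_le_exp]
          have h1 : 3 * (8 * (m * μ ^ 2) + 2 * B ^ 2) * l ^ 2 ≤ 30 * σ ^ 2 * l ^ 2 :=
            mul_le_mul_of_nonneg_right (by linarith) (sq_nonneg l)
          have h2 : 30 * σ ^ 2 * l ^ 2 = a ^ 2 / 120 := by
            rw [mul_assoc, ← mul_pow, mul_comm σ, hlσ]
            ring
          have h3 : l * (R + a * σ) = l * R + a ^ 2 / 60 := by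
            linear_combination a * hlσ
          linarith
  · have hRσ' : R ≤ σ := by
      refine (sq_le_sq₀ (by positivity) hσ.le).1 ?_
      rwa [hR2]
    have hpos : 0 < R + a * σ := by positivity
    calc _ ≤ bernExp p n (fun ω => ((R + a * σ) ^ 2)⁻¹ * ‖selSum y ω‖ ^ 2) := by
          refine bprob_le_bernExp hmn (fun ω => by positivity) fun ω hω => ?_
          rw [inv_mul_eq_div, one_le_div (by positivity)]
          exact pow_le_pow_left₀ hpos.le hω 2
      _ ≤ ((R + a * σ) ^ 2)⁻¹ * R ^ 2 := by
          rw [bernExp_const_mul]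
          exact mul_le_mul_of_nonneg_left hmean (by positivity)
      _ ≤ 1 - 1 / 120 * a ^ 2 := by
          rw [inv_mul_le_iff₀ (by positivity)]
          have h1 : R * (1 + a) ≤ R + a * σ := by
            linarith [mul_le_mul_of_nonneg_left hRσ' ha.le]
          have h2 : (R * (1 + a)) ^ 2 ≤ (R + a * σ) ^ 2 := pow_le_pow_left₀ (by positivity) h1 2
          have h3 : a ^ 2 ≤ 1 := pow_le_one₀ ha.le ha1
          have h4 : 1 ≤ (1 + a) ^ 2 * (1 - 1 / 120 * a ^ 2) := by nlinarith
          have h5 := mul_le_mul_of_nonneg_right h2 (by linarith : 0 ≤ 1 - 1 / 120 * a ^ 2)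
          have h6 := mul_le_mul_of_nonneg_left h4 (sq_nonneg R)
          linarith [mul_pow R (1 + a) 2]
      _ ≤ exp (-(1 / 120 * a ^ 2)) := Real.one_sub_le_exp_neg _
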